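/- arXiv:math/0204223 — 2 statements merged into one kernel-verified Lean document; each statement's English description precedes it below -/
import Mathlib

section
/- Consider the natural action of SL(3, ℂ) on the projective space P^N of plane curves of degree n in P² (i.e., on nonzero homogeneous forms of degree n in three variables up to scalar, with N = (n+1)(n+2)/2 − 1). If a curve C of degree n has a point of multiplicity strictly greater than 2n/3, then C is unstable in the sense of geometric invariant theory, i.e., 0 lies in the closure of the SL(3)-orbit of any representative of C in the space of degree-n forms. -/
/-- The group `SL(3, ℂ)`. -/
abbrev SL3 := Matrix.SpecialLinearGroup (Fin 3) ℂ

/-- The action of `g ∈ SL(3, ℂ)` on forms `f(X, Y, Z)` in three variables by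
linear substitution of the variables: `Xᵢ ↦ Σⱼ gᵢⱼ Xⱼ`. -/
noncomputable def formAct (g : SL3) (f : MvPolynomial (Fin 3) ℂ) :
    MvPolynomial (Fin 3) ℂ :=
  MvPolynomial.aeval
    (fun i => ∑ j, MvPolynomial.C ((g : Matrix (Fin 3) (Fin 3) ℂ) i j) *
      MvPolynomial.X j) f

open MvPolynomial Filter Topology

theorem formAct_mul (g h : SL3) (f : MvPolynomial (Fin 3) ℂ) :
    formAct (h * g) f = formAct g (formAct h f) := by
  unfold formAct
  rw [← AlgHom.comp_apply, comp_aeval]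
  congr 2
  funext i
  simp [Fin.sum_univ_three, Matrix.mul_apply, algHom_C]
  ring

theorem formAct_smul (g : SL3) (c : ℂ) (f : MvPolynomial (Fin 3) ℂ) :
    formAct g (c • f) = c • formAct g f := by
  simp [formAct]

theorem isHomogeneous_formAct (g : SL3) {n : ℕ} {f : MvPolynomial (Fin 3) ℂ}
    (hf : f.IsHomogeneous n) : (formAct g f).IsHomogeneous n := by
  have h := hf.aeval (n := 1)
    (fun i => ∑ j, C ((g : Matrix (Fin 3) (Fin 3) ℂ) i j) * X j)
    (fun i => IsHomogeneous.sum _ _ _ fun j _ => by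
      simpa using (isHomogeneous_C _ _).mul (isHomogeneous_X _ _))
  rwa [one_mul] at h

/-- Rescaling each variable `X i` by `a i` multiplies the coefficient at `d` by `∏ i, a i ^ d i`. -/
theorem coeff_aeval_C_mul_X {σ R : Type*} [Fintype σ] [CommSemiring R] (a : σ → R)
    (f : MvPolynomial σ R) (d : σ →₀ ℕ) :
    coeff d (aeval (fun i => C (a i) * X i) f) = (∏ i, a i ^ d i) * coeff d f := by
  classical
  induction f using MvPolynomial.induction_on' with
  | monomial u r =>
    have h : aeval (fun i => C (a i) * X i) (monomial u r) =
        monomial u ((∏ i, a i ^ u i) * r) := by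
      rw [aeval_monomial, Finsupp.prod_fintype _ _ (by simp), monomial_eq (s := u),
        Finsupp.prod_fintype _ _ (by simp)]
      simp only [mul_pow, Finset.prod_mul_distrib, algebraMap_eq, map_mul, map_prod, map_pow]
      ring
    rw [h, coeff_monomial, coeff_monomial]
    split_ifs with hu
    · rw [hu]
    · simp
  | add p q hp hq => rw [map_add, coeff_add, coeff_add, hp, hq, mul_add]

/-- The one-parameter subgroup `t ↦ diag(t, t, t⁻²)` of `SL(3, ℂ)`. -/
noncomputable def diagSL3 (t : ℂ) (ht : t ≠ 0) : SL3 :=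
  ⟨Matrix.diagonal ![t, t, (t ^ 2)⁻¹], by
    simp [Matrix.det_diagonal, Fin.prod_univ_three]
    field_simp⟩

theorem coeff_formAct_diagSL3 (t : ℂ) (ht : t ≠ 0) (f : MvPolynomial (Fin 3) ℂ)
    (d : Fin 3 →₀ ℕ) :
    coeff d (formAct (diagSL3 t ht) f) =
      t ^ d 0 * t ^ d 1 * (t ^ 2)⁻¹ ^ d 2 * coeff d f := by
  have h := coeff_aeval_C_mul_X ![t, t, (t ^ 2)⁻¹] f d
  rw [Fin.prod_univ_three] at h
  refine Eq.trans ?_ h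
  unfold formAct
  congr 3
  funext i
  simp [diagSL3, Matrix.diagonal_apply, apply_ite C, ite_mul]

/-- Consider the natural action of `SL(3, ℂ)` on the space of
plane curves of degree `n` (nonzero degree-`n` forms in `X, Y, Z` up to
scalar).  If the curve `C = {f = 0}` has a point of multiplicity strictly
greater than `2n/3` — i.e. after a linear change of coordinates moving the
point to `(0:0:1)`, every monomial `X^a Y^b Z^c` occurring in the equation has
`a + b > 2n/3` — then `C` is unstable: `0` lies in the closure of the
`SL(3, ℂ)`-orbit of any representative `c • f` (`c ≠ 0`) of `C` in the space
of degree-`n` forms (identified, coefficientwise, with a subspace of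
`(Fin 3 →₀ ℕ) → ℂ` with its product topology). -/
theorem statement3 (n : ℕ) (f : MvPolynomial (Fin 3) ℂ) (hf : f ≠ 0)
    (hhom : f.IsHomogeneous n)
    (hmult : ∃ g : SL3, ∀ d ∈ (formAct g f).support, 2 * n < 3 * (d 0 + d 1)) :
    ∀ c : ℂ, c ≠ 0 →
      (0 : (Fin 3 →₀ ℕ) → ℂ) ∈
        closure {v : (Fin 3 →₀ ℕ) → ℂ |
          ∃ g : SL3, v = fun d => MvPolynomial.coeff d (formAct g (c • f))} := by
  obtain ⟨g, hg⟩ := hmult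
  intro c _
  let F : ℂ → (Fin 3 →₀ ℕ) → ℂ := fun t d =>
    t ^ d 0 * t ^ d 1 * (t ^ 2)⁻¹ ^ d 2 * (c * coeff d (formAct g f))
  have hlim : Tendsto F (𝓝[≠] 0) (𝓝 0) := by
    rw [tendsto_pi_nhds]
    intro d
    by_cases hd : coeff d (formAct g f) = 0
    · simp [F, hd]
    have hdeg : d 0 + d 1 + d 2 = n := by
      rw [← isHomogeneous_formAct g hhom hd, Finsupp.weight_apply,
        Finsupp.sum_fintype _ _ (by simp), Fin.sum_univ_three]
      simp
    have hlt := hg d (mem_support_iff.mpr hd)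
    obtain ⟨k, hk⟩ : ∃ k, d 0 + d 1 = 2 * d 2 + (k + 1) :=
      ⟨d 0 + d 1 - 2 * d 2 - 1, by omega⟩
    have hpow : Tendsto (fun t : ℂ => t ^ (k + 1) * (c * coeff d (formAct g f)))
        (𝓝[≠] 0) (𝓝 0) := by
      refine Tendsto.mono_left ?_ nhdsWithin_le_nhds
      refine Continuous.tendsto' (by fun_prop) _ _ (by simp)
    refine hpow.congr' ?_
    filter_upwards [self_mem_nhdsWithin] with t (ht : t ≠ 0)
    simp only [F]
    rw [← pow_add (m := d 0), hk, pow_add t (2 * d 2), pow_mul, inv_pow]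
    field_simp
  refine mem_closure_of_tendsto hlim ?_
  filter_upwards [self_mem_nhdsWithin] with t (ht : t ≠ 0)
  refine ⟨g * diagSL3 t ht, ?_⟩
  funext d
  rw [formAct_mul, coeff_formAct_diagSL3, formAct_smul, coeff_smul, smul_eq_mul]
end

section
/- Let H and V be finite-dimensional complex vector spaces and let G = SL(H) × SL(V) act on Y = G(n, H ⊗ V) × G(m, H ⊗ V) (products of Grassmannians of subspaces), linearized by the ample line bundle (p, q) ∈ Pic(Y) with p, q > 0. A point (K, L) ∈ Y is unstable with respect to the restricted SL(V)-action if and only if there is a subspace V′ ⊆ V such that, setting K′ = K ∩ (H ⊗ V′) and L′ = L ∩ (H ⊗ V′), one has (p·dim K′ + q·dim L′)/dim V′ > (p·dim K + q·dim L)/dim V. -/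
open TensorProduct

/-- A (diagonalized) one-parameter subgroup `λ : ℂ* → SL(V)`, recorded by its
integer weight decomposition `V = ⊕_z V_z`, where `λ(t)` acts on the weight
space `wt z` by `t^z`.  The condition `det λ(t) = 1` says that the weights sum
to zero, counted with multiplicity. -/
structure OneParamSubgroup (V : Type) [AddCommGroup V] [Module ℂ V] where
  /-- the weight spaces -/
  wt : ℤ → Submodule ℂ V
  /-- the finitely many occurring weights -/
  supp : Finset ℤ
  wt_eq_bot : ∀ z ∉ supp, wt z = ⊥
  /-- `V` is the internal direct sum of the weight spaces -/
  internal : DirectSum.IsInternal wt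
  /-- determinant one: the weights sum to zero with multiplicity -/
  trace_zero : (∑ z ∈ supp, z * (Module.finrank ℂ ↥(wt z) : ℤ)) = 0

/-- For a one-parameter subgroup `λ` of `SL(V)` acting on `A ⊗ V` (trivially
on `A`), `weightFlag A lam z = ⊕_{z' ≥ z} A ⊗ V_{z'} ⊆ A ⊗ V` is the subspace
of weights at least `z`. -/
noncomputable def weightFlag (A : Type) [AddCommGroup A] [Module ℂ A]
    {V : Type} [AddCommGroup V] [Module ℂ V]
    (lam : OneParamSubgroup V) (z : ℤ) : Submodule ℂ (A ⊗[ℂ] V) :=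
  ⨆ z' : ℤ, ⨆ _ : z ≤ z',
    LinearMap.range (LinearMap.lTensor A (lam.wt z').subtype)

/-- The Hilbert–Mumford weight of a point `K` of a Grassmannian of subspaces
of `A ⊗ V` with respect to a one-parameter subgroup `λ` of `SL(V)` (acting
trivially on `A`), for the Plücker polarization `O(1)`:
`Σ_z z · (dim(K ∩ F_{≥ z}) − dim(K ∩ F_{≥ z+1}))`, so that
`μ(K, λ) = − hmWeight A lam K`. -/
noncomputable def hmWeight (A : Type) [AddCommGroup A] [Module ℂ A]
    {V : Type} [AddCommGroup V] [Module ℂ V]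
    (lam : OneParamSubgroup V) (K : Submodule ℂ (A ⊗[ℂ] V)) : ℤ :=
  ∑ z ∈ lam.supp,
    z * ((Module.finrank ℂ ↥(K ⊓ weightFlag A lam z) : ℤ) -
      (Module.finrank ℂ ↥(K ⊓ weightFlag A lam (z + 1)) : ℤ))

/-- Hilbert–Mumford instability of a point `(K, L)` of the product of
Grassmannians `G(n, H ⊗ V) × G(m, H ⊗ V)` for the restricted `SL(V)`-action,
linearized by the ample line bundle `(p, q) = O(p) ⊠ O(q)`: some
one-parameter subgroup `λ` of `SL(V)` has
`μ((K,L), λ) = −(p·wt_λ(K) + q·wt_λ(L)) < 0`. -/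
def PairUnstable {H V : Type} [AddCommGroup H] [Module ℂ H]
    [AddCommGroup V] [Module ℂ V] (p q : ℕ)
    (K L : Submodule ℂ (H ⊗[ℂ] V)) : Prop :=
  ∃ lam : OneParamSubgroup V,
    0 < (p : ℤ) * hmWeight H lam K + (q : ℤ) * hmWeight H lam L

/-- The subspace `A ⊗ S` of `A ⊗ V`. -/
noncomputable def tensorSubspace (A : Type) [AddCommGroup A] [Module ℂ A]
    {V : Type} [AddCommGroup V] [Module ℂ V] (S : Submodule ℂ V) : Submodule ℂ (A ⊗[ℂ] V) :=
  LinearMap.range (LinearMap.lTensor A S.subtype)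

section TensorSubspace

variable {A V : Type} [AddCommGroup A] [Module ℂ A] [AddCommGroup V] [Module ℂ V]

theorem tmul_mem_tensorSubspace {S : Submodule ℂ V} (a : A) {v : V} (hv : v ∈ S) :
    a ⊗ₜ[ℂ] v ∈ tensorSubspace A S :=
  ⟨a ⊗ₜ[ℂ] (⟨v, hv⟩ : S), by simp⟩

theorem tensorSubspace_le_iff {S : Submodule ℂ V} {T : Submodule ℂ (A ⊗[ℂ] V)} :
    tensorSubspace A S ≤ T ↔ ∀ (a : A), ∀ v ∈ S, a ⊗ₜ[ℂ] v ∈ T := by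
  refine ⟨fun h a v hv => h (tmul_mem_tensorSubspace a hv), ?_⟩
  rintro h _ ⟨x, rfl⟩
  induction x with
  | zero => simp
  | tmul a s => simpa using h a s s.2
  | add x y hx hy => rw [map_add]; exact T.add_mem hx hy

theorem tensorSubspace_mono {S T : Submodule ℂ V} (h : S ≤ T) :
    tensorSubspace A S ≤ tensorSubspace A T :=
  tensorSubspace_le_iff.2 fun a _ hv => tmul_mem_tensorSubspace a (h hv)

@[simp]
theorem tensorSubspace_bot : tensorSubspace A (⊥ : Submodule ℂ V) = ⊥ := by
  rw [eq_bot_iff, tensorSubspace_le_iff]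
  rintro a v hv
  simp [(Submodule.mem_bot ℂ).1 hv]

@[simp]
theorem tensorSubspace_top : tensorSubspace A (⊤ : Submodule ℂ V) = ⊤ := by
  rw [eq_top_iff]
  rintro x -
  induction x with
  | zero => simp
  | tmul a v => exact tmul_mem_tensorSubspace a trivial
  | add x y hx hy => exact Submodule.add_mem _ hx hy

theorem tensorSubspace_iSup {ι : Sort*} (S : ι → Submodule ℂ V) :
    tensorSubspace A (⨆ i, S i) = ⨆ i, tensorSubspace A (S i) := by
  refine le_antisymm (tensorSubspace_le_iff.2 fun a v hv => ?_)
    (iSup_le fun i => tensorSubspace_mono (le_iSup S i))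
  have h : ⨆ i, S i ≤ (⨆ i, tensorSubspace A (S i)).comap (TensorProduct.mk ℂ A V a) :=
    iSup_le fun i w hw => (le_iSup (fun i => tensorSubspace A (S i)) i)
      (tmul_mem_tensorSubspace a hw)
  exact h hv

/-- The dimension of `K ∩ (A ⊗ S)`. -/
noncomputable def interDim (K : Submodule ℂ (A ⊗[ℂ] V)) (S : Submodule ℂ V) : ℕ :=
  Module.finrank ℂ ↥(K ⊓ tensorSubspace A S)

@[simp]
theorem interDim_bot (K : Submodule ℂ (A ⊗[ℂ] V)) : interDim K ⊥ = 0 := by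
  rw [interDim, tensorSubspace_bot, inf_bot_eq, finrank_bot]

@[simp]
theorem interDim_top (K : Submodule ℂ (A ⊗[ℂ] V)) : interDim K ⊤ = Module.finrank ℂ K := by
  rw [interDim, tensorSubspace_top, inf_top_eq]

end TensorSubspace

namespace OneParamSubgroup

variable {V : Type} [AddCommGroup V] [Module ℂ V] (lam : OneParamSubgroup V)

/-- The subspace `⊕_{z' ≥ z} V_{z'}` of `V`. -/
noncomputable def flag (z : ℤ) : Submodule ℂ V :=
  ⨆ z' : ℤ, ⨆ _ : z ≤ z', lam.wt z'

theorem weightFlag_eq (A : Type) [AddCommGroup A] [Module ℂ A] (z : ℤ) :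
    weightFlag A lam z = tensorSubspace A (lam.flag z) := by
  simp only [flag, tensorSubspace_iSup]
  rfl

theorem hmWeight_eq {A : Type} [AddCommGroup A] [Module ℂ A] (K : Submodule ℂ (A ⊗[ℂ] V)) :
    hmWeight A lam K =
      ∑ z ∈ lam.supp, z * ((interDim K (lam.flag z) : ℤ) - interDim K (lam.flag (z + 1))) := by
  simp only [hmWeight, interDim]
  refine Finset.sum_congr rfl fun z _ => ?_
  rw [weightFlag_eq, weightFlag_eq]

theorem wt_le_flag {z z' : ℤ} (h : z ≤ z') : lam.wt z' ≤ lam.flag z :=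
  le_iSup₂_of_le z' h le_rfl

theorem flag_le_iff {z : ℤ} {S : Submodule ℂ V} :
    lam.flag z ≤ S ↔ ∀ z', z ≤ z' → lam.wt z' ≤ S :=
  iSup₂_le_iff

theorem flag_eq_sup (z : ℤ) : lam.flag z = lam.wt z ⊔ lam.flag (z + 1) := by
  refine le_antisymm (lam.flag_le_iff.2 fun z' hz => ?_)
    (sup_le (lam.wt_le_flag le_rfl) (lam.flag_le_iff.2 fun z' hz => lam.wt_le_flag (by omega)))
  rcases hz.eq_or_lt with rfl | h
  · exact le_sup_left
  · exact (lam.wt_le_flag (by omega)).trans le_sup_right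

theorem disjoint_wt_flag (z : ℤ) : Disjoint (lam.wt z) (lam.flag (z + 1)) :=
  (lam.internal.submodule_iSupIndep z).mono_right
    (lam.flag_le_iff.2 fun z' hz => le_iSup₂_of_le z' (by omega) le_rfl)

theorem finrank_flag [FiniteDimensional ℂ V] (z : ℤ) :
    Module.finrank ℂ (lam.flag z) =
      Module.finrank ℂ (lam.wt z) + Module.finrank ℂ (lam.flag (z + 1)) := by
  rw [← Submodule.finrank_sup_add_finrank_inf_eq, ← lam.flag_eq_sup,
    (lam.disjoint_wt_flag z).eq_bot, finrank_bot, add_zero]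

theorem flag_succ_of_notMem {z : ℤ} (hz : z ∉ lam.supp) : lam.flag (z + 1) = lam.flag z := by
  rw [lam.flag_eq_sup z, lam.wt_eq_bot z hz, bot_sup_eq]

theorem flag_eq_top {z : ℤ} (hz : ∀ z' ∈ lam.supp, z ≤ z') : lam.flag z = ⊤ := by
  rw [eq_top_iff, ← lam.internal.submodule_iSup_eq_top]
  refine iSup_le fun z' => ?_
  by_cases h : z' ∈ lam.supp
  · exact lam.wt_le_flag (hz z' h)
  · simp [lam.wt_eq_bot z' h]

theorem flag_eq_bot {z : ℤ} (hz : ∀ z' ∈ lam.supp, z' < z) : lam.flag z = ⊥ := by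
  rw [eq_bot_iff, flag_le_iff]
  intro z' h
  rw [lam.wt_eq_bot z' fun h' => absurd (hz z' h') (by omega)]

/-- Summation by parts along the flag of a one-parameter subgroup. -/
theorem sum_mul_sub_nonpos (f : Submodule ℂ V → ℤ) (hf : ∀ S, f S ≤ 0)
    (hbot : f ⊥ = 0) (htop : f ⊤ = 0) :
    ∑ z ∈ lam.supp, z * (f (lam.flag z) - f (lam.flag (z + 1))) ≤ 0 := by
  obtain ⟨N, hN⟩ : ∃ N : ℕ, ∀ z ∈ lam.supp, -(N : ℤ) ≤ z ∧ z < N := by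
    refine ⟨lam.supp.sup Int.natAbs + 1, fun z hz => ?_⟩
    have := Finset.le_sup (f := Int.natAbs) hz
    omega
  have hsub : lam.supp ⊆ Finset.Ico (-(N : ℤ)) N := fun z hz => Finset.mem_Ico.2 (hN z hz)
  have h_top : lam.flag (-(N : ℤ)) = ⊤ := lam.flag_eq_top fun z hz => (hN z hz).1
  have h_bot : lam.flag N = ⊥ := lam.flag_eq_bot fun z hz => (hN z hz).2
  rw [Finset.sum_subset hsub fun z _ hz => by rw [lam.flag_succ_of_notMem hz, sub_self, mul_zero]]
  have key : ∀ k : ℕ, ∑ z ∈ Finset.Ico (-(N : ℤ)) (-N + k),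
      z * (f (lam.flag z) - f (lam.flag (z + 1))) ≤ -((-N + k) * f (lam.flag (-N + k))) := by
    intro k
    induction k with
    | zero => simp [h_top, htop]
    | succ k ih =>
      have hIco : Finset.Ico (-(N : ℤ)) (-N + (k + 1 : ℕ)) =
          insert (-(N : ℤ) + k) (Finset.Ico (-(N : ℤ)) (-N + k)) := by
        ext z
        simp only [Finset.mem_Ico, Finset.mem_insert]
        omega
      rw [hIco, Finset.sum_insert (by simp)]
      have := hf (lam.flag (-N + k + 1))
      push_cast
      rw [← add_assoc]
      linarith
  have := key (2 * N)
  rw [show -(N : ℤ) + (2 * N : ℕ) = N by push_cast; ring, h_bot, hbot] at this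
  simpa using this

/-- The one-parameter subgroup with two weights attached to a decomposition `V = S ⊕ T`: it has
weight `dim T` on `S` and weight `-dim S` on `T`. -/
noncomputable def ofIsCompl {S T : Submodule ℂ V} (h : IsCompl S T)
    (hS : 0 < Module.finrank ℂ S) (hT : 0 < Module.finrank ℂ T) : OneParamSubgroup V where
  wt z := if z = Module.finrank ℂ T then S else if z = -(Module.finrank ℂ S : ℤ) then T else ⊥
  supp := {(Module.finrank ℂ T : ℤ), -(Module.finrank ℂ S : ℤ)}
  wt_eq_bot z hz := by
    simp only [Finset.mem_insert, Finset.mem_singleton, not_or] at hz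
    rw [if_neg hz.1, if_neg hz.2]
  internal := by
    have hne : -(Module.finrank ℂ S : ℤ) ≠ Module.finrank ℂ T := by omega
    rw [DirectSum.isInternal_submodule_iff_iSupIndep_and_iSup_eq_top]
    constructor
    · intro i
      dsimp only
      by_cases hi : i = Module.finrank ℂ T
      · rw [if_pos hi]
        refine h.disjoint.mono_right (iSup₂_le fun j hj => ?_)
        rw [if_neg (hi ▸ hj)]
        split_ifs <;> simp
      · rw [if_neg hi]
        split_ifs with hi'
        · refine h.disjoint.symm.mono_right (iSup₂_le fun j hj => ?_)
          rw [if_neg (show ¬j = -(Module.finrank ℂ S : ℤ) from hi' ▸ hj)]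
          split_ifs <;> simp
        · exact disjoint_bot_left
    · rw [eq_top_iff, ← h.sup_eq_top]
      refine sup_le (le_iSup_of_le (Module.finrank ℂ T : ℤ) ?_)
        (le_iSup_of_le (-(Module.finrank ℂ S : ℤ)) ?_)
      · rw [if_pos rfl]
      · rw [if_neg hne, if_pos rfl]
  trace_zero := by
    have hne : -(Module.finrank ℂ S : ℤ) ≠ Module.finrank ℂ T := by omega
    rw [Finset.sum_pair hne.symm, if_pos rfl, if_neg hne, if_pos rfl]
    ring

section OfIsCompl

variable {S T : Submodule ℂ V} (h : IsCompl S T)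
  (hS : 0 < Module.finrank ℂ S) (hT : 0 < Module.finrank ℂ T)

theorem mem_supp_ofIsCompl {z : ℤ} : z ∈ (ofIsCompl h hS hT).supp ↔
    z = Module.finrank ℂ T ∨ z = -(Module.finrank ℂ S : ℤ) := by
  simp [ofIsCompl]

theorem flag_ofIsCompl {z : ℤ} (hz : -(Module.finrank ℂ S : ℤ) < z)
    (hz' : z ≤ Module.finrank ℂ T) : (ofIsCompl h hS hT).flag z = S := by
  refine le_antisymm ((flag_le_iff _).2 fun z' hz' => ?_) ?_
  · dsimp only [ofIsCompl]
    split_ifs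
    · exact le_rfl
    · omega
    · exact bot_le
  · refine le_trans (le_of_eq ?_) (wt_le_flag _ hz')
    exact (if_pos rfl).symm

theorem hmWeight_ofIsCompl [FiniteDimensional ℂ V] (A : Type) [AddCommGroup A] [Module ℂ A]
    (K : Submodule ℂ (A ⊗[ℂ] V)) :
    hmWeight A (ofIsCompl h hS hT) K =
      Module.finrank ℂ V * interDim K S -
        Module.finrank ℂ S * Module.finrank ℂ K := by
  have hne : (Module.finrank ℂ T : ℤ) ≠ -(Module.finrank ℂ S : ℤ) := by omega
  have hV := Submodule.finrank_add_eq_of_isCompl h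
  have hb : (ofIsCompl h hS hT).flag (Module.finrank ℂ T + 1) = ⊥ :=
    flag_eq_bot _ fun z hz => by rw [mem_supp_ofIsCompl] at hz; omega
  have ht : (ofIsCompl h hS hT).flag (-(Module.finrank ℂ S : ℤ)) = ⊤ :=
    flag_eq_top _ fun z hz => by rw [mem_supp_ofIsCompl] at hz; omega
  rw [hmWeight_eq]
  change ∑ z ∈ {(Module.finrank ℂ T : ℤ), -(Module.finrank ℂ S : ℤ)}, _ = _
  rw [Finset.sum_pair hne, hb, ht, flag_ofIsCompl h hS hT (by omega) le_rfl,
    flag_ofIsCompl h hS hT (by omega) (by omega), ← hV]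
  rw [interDim_bot, interDim_top]
  push_cast
  ring

end OfIsCompl

end OneParamSubgroup

/-- Let `SL(H) × SL(V)` act on
`Y = G(n, H ⊗ V) × G(m, H ⊗ V)`, linearized by the ample line bundle `(p, q)`
with `p, q > 0`.  A point `(K, L) ∈ Y` is unstable for the restricted
`SL(V)`-action if and only if there is a subspace `V' ⊆ V` such that, with
`K' = K ∩ (H ⊗ V')` and `L' = L ∩ (H ⊗ V')`,
`(p·dim K' + q·dim L') / dim V' > (p·dim K + q·dim L) / dim V`. -/
theorem statement13 (H V : Type) [AddCommGroup H] [Module ℂ H]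
    [AddCommGroup V] [Module ℂ V]
    [FiniteDimensional ℂ H] [FiniteDimensional ℂ V]
    (p q n m : ℕ) (hp : 0 < p) (hq : 0 < q)
    (K L : Submodule ℂ (H ⊗[ℂ] V))
    (hK : Module.finrank ℂ ↥K = n) (hL : Module.finrank ℂ ↥L = m) :
    PairUnstable p q K L ↔
      ∃ V' : Submodule ℂ V,
        (p * Module.finrank ℂ
            ↥(K ⊓ LinearMap.range (LinearMap.lTensor H V'.subtype)) +
         q * Module.finrank ℂ
            ↥(L ⊓ LinearMap.range (LinearMap.lTensor H V'.subtype))) *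
          Module.finrank ℂ V >
        (p * Module.finrank ℂ ↥K + q * Module.finrank ℂ ↥L) *
          Module.finrank ℂ ↥V' := by
  change _ ↔ ∃ V' : Submodule ℂ V,
    (p * interDim K V' +
      q * interDim L V') * Module.finrank ℂ V >
    (p * Module.finrank ℂ ↥K + q * Module.finrank ℂ ↥L) * Module.finrank ℂ ↥V'
  constructor
  · rintro ⟨lam, hlam⟩
    by_contra! hle
    let f : Submodule ℂ V → ℤ := fun S =>
      (p * interDim K S +
        q * interDim L S) * Module.finrank ℂ V -
      (p * Module.finrank ℂ ↥K + q * Module.finrank ℂ ↥L) * Module.finrank ℂ ↥S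
    have hf := lam.sum_mul_sub_nonpos f (fun S => sub_nonpos.2 (by exact_mod_cast hle S))
      (by simp [f]) (by simp [f])
    have hsum : ∑ z ∈ lam.supp, z * (f (lam.flag z) - f (lam.flag (z + 1))) =
        (p * hmWeight H lam K + q * hmWeight H lam L) * Module.finrank ℂ V -
        (p * Module.finrank ℂ ↥K + q * Module.finrank ℂ ↥L) *
          ∑ z ∈ lam.supp, z * (Module.finrank ℂ ↥(lam.wt z) : ℤ) := by
      simp only [lam.hmWeight_eq, Finset.mul_sum, Finset.sum_mul,
        ← Finset.sum_add_distrib, ← Finset.sum_sub_distrib]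
      refine Finset.sum_congr rfl fun z _ => ?_
      simp only [f, lam.finrank_flag z]
      push_cast
      ring
    rw [hsum, lam.trace_zero, mul_zero, sub_zero] at hf
    have hV : Module.finrank ℂ V = 0 := by
      by_contra hV
      have : (0 : ℤ) < Module.finrank ℂ V := by omega
      exact absurd hf (not_le.2 (mul_pos hlam this))
    have : Subsingleton V := Module.finrank_zero_iff.1 hV
    have hzero : ∀ M : Submodule ℂ (H ⊗[ℂ] V), hmWeight H lam M = 0 := fun M =>
      (lam.hmWeight_eq M).trans <| Finset.sum_eq_zero fun z _ => by
        rw [Subsingleton.elim (lam.flag z) (lam.flag (z + 1)),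
          sub_self, mul_zero]
    simp [hzero] at hlam
  · rintro ⟨S, hlt⟩
    obtain ⟨T, h⟩ := S.exists_isCompl
    have hS : 0 < Module.finrank ℂ S := by
      rw [Nat.pos_iff_ne_zero, Ne, Submodule.finrank_eq_zero]
      rintro rfl
      simp at hlt
    have hT : 0 < Module.finrank ℂ T := by
      rw [Nat.pos_iff_ne_zero, Ne, Submodule.finrank_eq_zero]
      rintro rfl
      rw [eq_top_of_isCompl_bot h] at hlt
      simp at hlt
    refine ⟨OneParamSubgroup.ofIsCompl h hS hT, ?_⟩
    rw [OneParamSubgroup.hmWeight_ofIsCompl, OneParamSubgroup.hmWeight_ofIsCompl]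
    zify at hlt
    linarith
end
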